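/- Let m, n, p, q ≥ 2 be integers, D be an EAS division ring, and φ : M_{m×n}(D) → M_{p×q}(D) be an adjacency preserver such that φ([[A, 0],[0, 0]]) = [[A, 0],[0, 0]] for every A ∈ M_2(D) (the left block matrix being m×n, the right one p×q). Then p ≥ m, q ≥ n, and there exist invertible matrices T ∈ GL_p(D) and S ∈ GL_q(D) such that φ(M) = T [[M, 0],[0, 0]] S for every matrix M ∈ R(e₁) ∪ L(ᵗf₁), where e₁ ∈ D^n is the first standard basis row vector and ᵗf₁ ∈ ᵗD^m is the first standard basis column vector. -/

import Mathlib

open Matrix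

variable {D : Type*} [DivisionRing D]

/-- The rank of a matrix over a division ring: the dimension of its row space,
i.e. of the left `D`-subspace of `D^n` spanned by the rows. -/
noncomputable def rowRank {m n : ℕ} (A : Matrix (Fin m) (Fin n) D) : ℕ :=
  Module.finrank D (Submodule.span D (Set.range fun i => A i))

/-- Two matrices are adjacent if their difference has rank one. -/
def Adjacent {m n : ℕ} (A B : Matrix (Fin m) (Fin n) D) : Prop :=
  rowRank (A - B) = 1

/-- `R(x)`: the set of matrices of the form `ᵗu x` for a fixed row vector `x`. -/
def Rvec {m n : ℕ} (x : Fin n → D) : Set (Matrix (Fin m) (Fin n) D) :=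
  { M | ∃ u : Fin m → D, ∀ i j, M i j = u i * x j }

/-- `L(ᵗy)`: the set of matrices of the form `ᵗy v` for a fixed column vector `ᵗy`. -/
def Lvec {m n : ℕ} (y : Fin m → D) : Set (Matrix (Fin m) (Fin n) D) :=
  { M | ∃ v : Fin n → D, ∀ i j, M i j = y i * v j }

/-- `R_d`: the matrices whose row space is contained in `d`. -/
def Rsub {m n : ℕ} (d : Submodule D (Fin n → D)) : Set (Matrix (Fin m) (Fin n) D) :=
  { M | ∀ i, M i ∈ d }

/-- `L_e`: the matrices whose column space (a right subspace, i.e. a `Dᵐᵒᵖ`-submodule)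
is contained in `e`. -/
def Lsub {m n : ℕ} (e : Submodule Dᵐᵒᵖ (Fin m → D)) : Set (Matrix (Fin m) (Fin n) D) :=
  { M | ∀ j, (fun i => M i j) ∈ e }

/-- The orthogonal set of a set `e` of column vectors. -/
def perpSet {m : ℕ} (e : Set (Fin m → D)) : Set (Fin m → D) :=
  { u | ∀ v ∈ e, ∑ i, u i * v i = 0 }

/-- The `p × q` matrix with upper-left block `B` and zeros elsewhere. -/
def pad {m n : ℕ} (p q : ℕ) (B : Matrix (Fin m) (Fin n) D) :
    Matrix (Fin p) (Fin q) D :=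
  Matrix.of fun i j =>
    if hi : (i : ℕ) < m then if hj : (j : ℕ) < n then B ⟨i, hi⟩ ⟨j, hj⟩ else 0 else 0

/-- `φ` is degenerate with respect to `A`. -/
def DegenerateAt {m n p q : ℕ} (φ : Matrix (Fin m) (Fin n) D → Matrix (Fin p) (Fin q) D)
    (A : Matrix (Fin m) (Fin n) D) : Prop :=
  ∃ x : Fin p → D, x ≠ 0 ∧ ∃ y : Fin q → D, y ≠ 0 ∧
    ∀ M : Matrix (Fin m) (Fin n) D, rowRank M ≤ 1 →
      φ (A + M) - φ A ∈ Rvec y ∪ Lvec x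

/-- `φ` is degenerate: degenerate with respect to every matrix. -/
def Degenerate {m n p q : ℕ} (φ : Matrix (Fin m) (Fin n) D → Matrix (Fin p) (Fin q) D) :
    Prop :=
  ∀ A, DegenerateAt φ A

/-- A map (sending `0` to `0`) is degenerate with respect to `0` iff it maps every matrix of
rank at most one into `R(y) ∪ L(ᵗx)` for some nonzero `y`, `x`. -/
def DegZero {m n p q : ℕ} (φ : Matrix (Fin m) (Fin n) D → Matrix (Fin p) (Fin q) D) :
    Prop :=
  ∃ x : Fin p → D, x ≠ 0 ∧ ∃ y : Fin q → D, y ≠ 0 ∧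
    ∀ M : Matrix (Fin m) (Fin n) D, rowRank M ≤ 1 → φ M ∈ Rvec y ∪ Lvec x

/-- A standard adjacency preserver. -/
def Standard {m n p q : ℕ} (φ : Matrix (Fin m) (Fin n) D → Matrix (Fin p) (Fin q) D) :
    Prop :=
  (m ≤ p ∧ n ≤ q ∧ ∃ τ : D ≃+* D, ∃ T : Matrix (Fin p) (Fin p) D,
    ∃ S : Matrix (Fin q) (Fin q) D, ∃ R : Matrix (Fin p) (Fin q) D,
    IsUnit T ∧ IsUnit S ∧ ∀ A, φ A = T * pad p q (A.map τ) * S + R) ∨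
  (n ≤ p ∧ m ≤ q ∧ ∃ σ : D → D, Function.Bijective σ ∧ σ 1 = 1 ∧
    (∀ a b, σ (a + b) = σ a + σ b) ∧ (∀ a b, σ (a * b) = σ b * σ a) ∧
    ∃ T : Matrix (Fin p) (Fin p) D, ∃ S : Matrix (Fin q) (Fin q) D,
    ∃ R : Matrix (Fin p) (Fin q) D, IsUnit T ∧ IsUnit S ∧
    ∀ A, φ A = T * pad p q (A.map σ).transpose * S + R)

/-- A division ring is EAS if every (unital) ring endomorphism of it is surjective. -/
def EAS (D : Type*) [DivisionRing D] : Prop :=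
  ∀ f : D →+* D, Function.Surjective f

/-- A set of matrices is adjacent if any two distinct members are adjacent. -/
def IsAdjacentSet {m n : ℕ} (S : Set (Matrix (Fin m) (Fin n) D)) : Prop :=
  ∀ A ∈ S, ∀ B ∈ S, A ≠ B → Adjacent A B

@[simp] theorem vecMulVec_zero_right {m n : ℕ} (v : Fin m → D) :
    vecMulVec v (0 : Fin n → D) = 0 := by
  ext i j
  simp [vecMulVec_apply]

theorem eq_zero_of_vecMulVec_eq_zero {m n : ℕ} {v : Fin m → D} {x : Fin n → D} (hv : v ≠ 0)
    (h : vecMulVec v x = 0) : x = 0 := by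
  obtain ⟨i, hi⟩ := Function.ne_iff.1 hv
  ext j
  exact (mul_eq_zero.1 (congrFun (congrFun h i) j)).resolve_left hi

/-- Two matrices differ by a matrix of rank at most one. -/
def OuterDiff {m n : ℕ} (A B : Matrix (Fin m) (Fin n) D) : Prop :=
  ∃ (s : Fin m → D) (r : Fin n → D), A - B = vecMulVec s r

/-- `φ` is injective on pairs of matrices at rank distance at most one, and preserves this
relation. -/
def PreservesOuterDiff {m n p q : ℕ}
    (φ : Matrix (Fin m) (Fin n) D → Matrix (Fin p) (Fin q) D) : Prop :=
  ∀ A B, A ≠ B → OuterDiff A B → φ A ≠ φ B ∧ OuterDiff (φ A) (φ B)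

/-- Right linear independence of a pair of columns. -/
def RightIndep {k : ℕ} (v w : Fin k → D) : Prop :=
  ∀ s t : D, (∀ i, v i * s + w i * t = 0) → s = 0 ∧ t = 0

/-- Truncate a vector, or extend it by zeros, to length `k`. -/
def padVec {l : ℕ} (k : ℕ) (a : Fin l → D) : Fin k → D :=
  fun i => if h : (i : ℕ) < l then a ⟨i, h⟩ else 0

theorem adjacent_iff {m n : ℕ} (A B : Matrix (Fin m) (Fin n) D) :
    Adjacent A B ↔ A ≠ B ∧ OuterDiff A B := by
  unfold Adjacent rowRank OuterDiff
  rw [← sub_ne_zero]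
  generalize A - B = M
  rw [finrank_eq_one_iff']
  constructor
  · rintro ⟨⟨v, hv⟩, hv0, hspan⟩
    have hrow : ∀ i, ∃ c : D, c • v = M i := fun i => by
      obtain ⟨c, hc⟩ := hspan ⟨M i, Submodule.subset_span ⟨i, rfl⟩⟩
      exact ⟨c, congrArg Subtype.val hc⟩
    choose c hc using hrow
    refine ⟨?_, c, v, ?_⟩
    · rintro rfl
      apply hv0
      have hbot : Submodule.span D (Set.range fun i => (0 : Matrix (Fin m) (Fin n) D) i) = ⊥ := by
        rw [Submodule.span_eq_bot]
        rintro _ ⟨i, rfl⟩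
        rfl
      rw [hbot] at hv
      exact Subtype.ext ((Submodule.mem_bot D).1 hv)
    · ext i j
      rw [← hc i]
      rfl
  · rintro ⟨hM, s, r, rfl⟩
    have hs : s ≠ 0 := by rintro rfl; simp at hM
    have hr : r ≠ 0 := by rintro rfl; simp at hM
    obtain ⟨i, hi⟩ := Function.ne_iff.1 hs
    have hrow : ∀ i, vecMulVec s r i = s i • r := fun i => rfl
    have hmem : r ∈ Submodule.span D (Set.range fun i => vecMulVec s r i) := by
      have h1 : s i • r ∈ Submodule.span D (Set.range fun i => vecMulVec s r i) :=
        Submodule.subset_span ⟨i, rfl⟩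
      have h2 := Submodule.smul_mem _ (s i)⁻¹ h1
      rwa [smul_smul, inv_mul_cancel₀ hi, one_smul] at h2
    refine ⟨⟨r, hmem⟩, fun h => hr (congrArg Subtype.val h), ?_⟩
    rintro ⟨w, hw⟩
    have hle : Submodule.span D (Set.range fun i => vecMulVec s r i) ≤ Submodule.span D {r} := by
      rw [Submodule.span_le]
      rintro _ ⟨i, rfl⟩
      exact Submodule.mem_span_singleton.2 ⟨s i, (hrow i).symm⟩
    obtain ⟨c, hc⟩ := Submodule.mem_span_singleton.1 (hle hw)
    exact ⟨c, Subtype.ext hc⟩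

section PadVec

variable {l k : ℕ}

theorem padVec_add (a b : Fin l → D) : padVec k (a + b) = padVec k a + padVec k b := by
  ext i
  simp only [padVec, Pi.add_apply]
  split_ifs <;> simp

theorem padVec_sub (a b : Fin l → D) : padVec k (a - b) = padVec k a - padVec k b := by
  ext i
  simp only [padVec, Pi.sub_apply]
  split_ifs <;> simp

theorem padVec_smul (t : D) (a : Fin l → D) : padVec k (t • a) = t • padVec k a := by
  ext i
  simp only [padVec, Pi.smul_apply]
  split_ifs <;> simp

theorem padVec_op_smul (t : D) (a : Fin l → D) :
    padVec k (MulOpposite.op t • a) = MulOpposite.op t • padVec k a := by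
  ext i
  simp only [padVec, Pi.smul_apply]
  split_ifs <;> simp

theorem padVec_castLE (hlk : l ≤ k) (a : Fin l → D) (i : Fin l) :
    padVec k a (Fin.castLE hlk i) = a i := by
  simp [padVec]

theorem padVec_injective (hlk : l ≤ k) :
    Function.Injective (padVec k : (Fin l → D) → Fin k → D) := fun a b hab => by
  ext i
  rw [← padVec_castLE hlk a, hab, padVec_castLE]

@[simp] theorem padVec_zero : padVec k (0 : Fin l → D) = 0 := by
  ext i
  simp [padVec]

theorem RightIndep.padVec (hlk : l ≤ k) {v w : Fin l → D} (hvw : RightIndep v w) :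
    RightIndep (padVec k v) (padVec k w) := fun s t h =>
  hvw s t fun i => by simpa only [padVec_castLE] using h (Fin.castLE hlk i)

theorem pad_vecMulVec {m n : ℕ} (p q : ℕ) (v : Fin m → D) (x : Fin n → D) :
    pad p q (vecMulVec v x) = vecMulVec (padVec p v) (padVec q x) := by
  ext i j
  simp only [pad, padVec, vecMulVec_apply, of_apply]
  split_ifs <;> simp

theorem pad_add {m n : ℕ} (p q : ℕ) (A B : Matrix (Fin m) (Fin n) D) :
    pad p q (A + B) = pad p q A + pad p q B := by
  ext i j
  simp only [pad, Matrix.add_apply, of_apply]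
  split_ifs <;> simp

end PadVec

section RightIndep

variable {k n : ℕ} {v w : Fin k → D}

theorem RightIndep.symm (hvw : RightIndep v w) : RightIndep w v := fun s t h =>
  (hvw t s fun i => by rw [add_comm]; exact h i).symm

theorem RightIndep.left_ne_zero (hvw : RightIndep v w) : v ≠ 0 := by
  rintro rfl
  exact one_ne_zero (hvw 1 0 fun i => by simp).1

theorem RightIndep.add_op_smul (hvw : RightIndep v w) (t : D) :
    RightIndep (v + MulOpposite.op t • w) w := fun a b h => by
  have h1 := hvw a (t * a + b) fun i => by
    rw [← h i]
    simp only [Pi.add_apply, Pi.smul_apply, MulOpposite.smul_eq_mul_unop, MulOpposite.unop_op]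
    noncomm_ring
  obtain ⟨rfl, h2⟩ := h1
  simpa using h2

theorem RightIndep.op_smul_right (hvw : RightIndep v w) {t : D} (ht : t ≠ 0) :
    RightIndep v (MulOpposite.op t • w) := fun a b h => by
  have h1 := hvw a (t * b) fun i => by
    rw [← h i]
    simp [mul_assoc]
  exact ⟨h1.1, (mul_eq_zero.1 h1.2).resolve_left ht⟩

theorem RightIndep.eq_zero_of_vecMulVec_add (hvw : RightIndep v w) {x y : Fin n → D}
    (h : vecMulVec v x + vecMulVec w y = 0) : x = 0 ∧ y = 0 := by
  have h1 : ∀ j, x j = 0 ∧ y j = 0 := fun j => hvw _ _ fun i => congrFun (congrFun h i) j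
  exact ⟨funext fun j => (h1 j).1, funext fun j => (h1 j).2⟩

/-- If `v ⊗ x + w ⊗ y` has rank at most one with `v`, `w` independent and `y ≠ 0`, then `x` is a
multiple of `y`. -/
theorem RightIndep.exists_smul_eq (hvw : RightIndep v w) {x y r : Fin n → D} {s : Fin k → D}
    (h : vecMulVec v x + vecMulVec w y = vecMulVec s r) (hy : y ≠ 0) : ∃ c : D, x = c • y := by
  have hr : r ≠ 0 := by
    rintro rfl
    rw [vecMulVec_zero_right] at h
    exact hy (hvw.eq_zero_of_vecMulVec_add h).2
  obtain ⟨j, hj⟩ := Function.ne_iff.1 hr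
  have hj : r j ≠ 0 := hj
  have hs : s = MulOpposite.op (x j * (r j)⁻¹) • v + MulOpposite.op (y j * (r j)⁻¹) • w := by
    ext i
    have h1 : v i * x j + w i * y j = s i * r j := congrFun (congrFun h i) j
    simp only [Pi.add_apply, Pi.smul_apply, MulOpposite.smul_eq_mul_unop, MulOpposite.unop_op]
    rw [← mul_assoc, ← mul_assoc, ← add_mul, h1, mul_assoc, mul_inv_cancel₀ hj, mul_one]
  rw [hs, add_vecMulVec, ← vecMulVec_smul', ← vecMulVec_smul', ← sub_eq_zero] at h
  have h2 := hvw.eq_zero_of_vecMulVec_add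
    (x := x - (x j * (r j)⁻¹) • r) (y := y - (y j * (r j)⁻¹) • r) (by
      rw [← h, vecMulVec_sub, vecMulVec_sub]; abel)
  have hx := sub_eq_zero.1 h2.1
  have hy' := sub_eq_zero.1 h2.2
  have hyj : y j ≠ 0 := by
    intro h0
    rw [h0, zero_mul, zero_smul] at hy'
    exact hy hy'
  refine ⟨x j * (y j)⁻¹, ?_⟩
  rw [hy', smul_smul]
  nth_rw 1 [hx]
  congr 1
  simp only [Pi.smul_apply, smul_eq_mul, mul_assoc, inv_mul_cancel₀ hj, mul_one]
  rw [inv_mul_cancel_left₀ hyj]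

theorem vecMulVec_right_injective (hv : v ≠ 0) {x y : Fin n → D}
    (h : vecMulVec v x = vecMulVec v y) : x = y := by
  rw [← sub_eq_zero, ← vecMulVec_sub] at h
  exact sub_eq_zero.1 (eq_zero_of_vecMulVec_eq_zero hv h)

/-- A matrix at rank distance at most one from all `v ⊗ a`, with `a` supported on the first two
coordinates, is of the form `v ⊗ x`. -/
theorem exists_eq_vecMulVec (hn : 2 ≤ n) (hv : v ≠ 0) {Y : Matrix (Fin k) (Fin n) D}
    (h : ∀ a : Fin 2 → D, OuterDiff Y (vecMulVec v (padVec n a))) : ∃ x, Y = vecMulVec v x := by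
  obtain ⟨s, r, hsr⟩ := h 0
  rw [padVec_zero, vecMulVec_zero_right, sub_zero] at hsr
  by_cases hind : RightIndep s v
  · have key : ∀ a : Fin 2 → D, a ≠ 0 → ∃ c : D, r = c • padVec n a := fun a ha => by
      obtain ⟨s', r', h'⟩ := h (-a)
      refine hind.exists_smul_eq (s := s') (r := r') ?_ fun h0 => ha ?_
      · rw [← h', hsr, ← zero_sub, padVec_sub, padVec_zero, vecMulVec_sub, vecMulVec_zero_right]
        abel
      · exact padVec_injective hn (h0.trans padVec_zero.symm)
    obtain ⟨c, hc⟩ := key ![1, 0] fun h0 => one_ne_zero (congrFun h0 0)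
    obtain ⟨d, hd⟩ := key ![0, 1] fun h0 => one_ne_zero (congrFun h0 1)
    rw [← padVec_smul] at hc hd
    have hcd := congrFun (padVec_injective hn (hc.symm.trans hd)) 0
    have hc0 : c = 0 := by simpa using hcd
    refine ⟨0, ?_⟩
    rw [hsr, hc, hc0, zero_smul, padVec_zero, vecMulVec_zero_right, vecMulVec_zero_right]
  · simp only [RightIndep, not_forall] at hind
    obtain ⟨α, β, hαβ, hne⟩ := hind
    have hα : α ≠ 0 := by
      rintro rfl
      refine hne ⟨rfl, ?_⟩
      obtain ⟨i, hi⟩ := Function.ne_iff.1 hv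
      have := hαβ i
      rw [mul_zero, zero_add] at this
      exact (mul_eq_zero.1 this).resolve_left hi
    have hs : s = MulOpposite.op (-(β * α⁻¹)) • v := by
      ext i
      have := eq_neg_of_add_eq_zero_left (hαβ i)
      simp only [Pi.smul_apply, MulOpposite.smul_eq_mul_unop, MulOpposite.unop_op]
      rw [mul_neg, ← mul_assoc, ← neg_mul, ← this, mul_assoc, mul_inv_cancel₀ hα, mul_one]
    exact ⟨(-(β * α⁻¹)) • r, by rw [hsr, hs, vecMulVec_smul']⟩

end RightIndep

section Main

variable {m n p q : ℕ} {φ : Matrix (Fin m) (Fin n) D → Matrix (Fin p) (Fin q) D}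

theorem PreservesOuterDiff.outerDiff (hφ : PreservesOuterDiff φ)
    {A B : Matrix (Fin m) (Fin n) D} (h : OuterDiff A B) : OuterDiff (φ A) (φ B) := by
  by_cases hAB : A = B
  · exact ⟨0, 0, by simp [hAB]⟩
  · exact (hφ A B hAB h).2

theorem PreservesOuterDiff.vecMulVec_injective (hφ : PreservesOuterDiff φ)
    {v : Fin m → D} (hv : v ≠ 0) {x y : Fin n → D}
    (h : φ (vecMulVec v x) = φ (vecMulVec v y)) : x = y := by
  by_contra hxy
  exact (hφ _ _ (fun h' => hxy (vecMulVec_right_injective hv h'))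
    ⟨v, x - y, (vecMulVec_sub _ _ _).symm⟩).1 h

/-- `φ` fixes the matrices supported on the upper-left `2 × 2` block. -/
def FixesCorner {m n p q : ℕ} (φ : Matrix (Fin m) (Fin n) D → Matrix (Fin p) (Fin q) D) : Prop :=
  ∀ A : Matrix (Fin 2) (Fin 2) D, φ (pad m n A) = pad p q A

theorem FixesCorner.apply_vecMulVec_add (h : FixesCorner φ) (v w a b : Fin 2 → D) :
    φ (vecMulVec (padVec m v) (padVec n a) + vecMulVec (padVec m w) (padVec n b)) =
      vecMulVec (padVec p v) (padVec q a) + vecMulVec (padVec p w) (padVec q b) := by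
  simpa only [pad_add, pad_vecMulVec] using h (vecMulVec v a + vecMulVec w b)

theorem FixesCorner.apply_vecMulVec (h : FixesCorner φ) (v a : Fin 2 → D) :
    φ (vecMulVec (padVec m v) (padVec n a)) = vecMulVec (padVec p v) (padVec q a) := by
  simpa only [pad_vecMulVec] using h (vecMulVec v a)

theorem exists_apply_eq_add (hp : 2 ≤ p) (hq : 2 ≤ q) (hφ : PreservesOuterDiff φ)
    (h : FixesCorner φ) {v : Fin 2 → D} (hv : v ≠ 0) (w b : Fin 2 → D) (u : Fin n → D) :
    ∃ x, φ (vecMulVec (padVec m v) u + vecMulVec (padVec m w) (padVec n b)) =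
      vecMulVec (padVec p v) x + vecMulVec (padVec p w) (padVec q b) := by
  have hv' : padVec p v ≠ 0 := fun h0 => hv (padVec_injective hp (h0.trans padVec_zero.symm))
  obtain ⟨x, hx⟩ := exists_eq_vecMulVec (n := q) hq hv'
    (Y := φ (vecMulVec (padVec m v) u + vecMulVec (padVec m w) (padVec n b)) -
      vecMulVec (padVec p w) (padVec q b)) fun a => by
    obtain ⟨s, r, hsr⟩ := hφ.outerDiff
      (A := vecMulVec (padVec m v) u + vecMulVec (padVec m w) (padVec n b))
      (B := vecMulVec (padVec m v) (padVec n a) + vecMulVec (padVec m w) (padVec n b))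
      ⟨padVec m v, u - padVec n a, by rw [vecMulVec_sub]; abel⟩
    refine ⟨s, r, ?_⟩
    rw [← hsr, h.apply_vecMulVec_add]
    abel
  exact ⟨x, by rw [← hx]; abel⟩

theorem exists_apply_eq_vecMulVec (hp : 2 ≤ p) (hq : 2 ≤ q) (hφ : PreservesOuterDiff φ)
    (h : FixesCorner φ) {v : Fin 2 → D} (hv : v ≠ 0) (u : Fin n → D) :
    ∃ x, φ (vecMulVec (padVec m v) u) = vecMulVec (padVec p v) x := by
  simpa using exists_apply_eq_add hp hq hφ h hv 0 0 u

/-- Only trivial combinations of a vector outside the span of the first two coordinates and a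
nonzero vector in that span agree. -/
theorem smul_padVec_eq {x : Fin q → D} (hx : ∀ a : Fin 2 → D, x ≠ padVec q a) {α β : D}
    {a : Fin 2 → D} (ha : padVec q a ≠ 0) (h : α • x = β • padVec q a) : α = 0 ∧ β = 0 := by
  have hα : α = 0 := by
    by_contra hα
    refine hx (α⁻¹ • β • a) ?_
    rw [padVec_smul, padVec_smul, ← h, smul_smul, inv_mul_cancel₀ hα, one_smul]
  refine ⟨hα, ?_⟩
  rw [hα, zero_smul] at h
  exact (smul_eq_zero.1 h.symm).resolve_right ha

theorem apply_add_of_notMem (hm : 2 ≤ m) (hp : 2 ≤ p) (hq : 2 ≤ q)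
    (hφ : PreservesOuterDiff φ) (h : FixesCorner φ) {v w : Fin 2 → D} (hvw : RightIndep v w)
    {u : Fin n → D} (hu : ∀ a : Fin 2 → D, u ≠ padVec n a) {x : Fin q → D}
    (hx : φ (vecMulVec (padVec m v) u) = vecMulVec (padVec p v) x)
    {a : Fin 2 → D} (ha : a ≠ 0) :
    φ (vecMulVec (padVec m v) u + vecMulVec (padVec m w) (padVec n a)) =
        vecMulVec (padVec p v) x + vecMulVec (padVec p w) (padVec q a) ∧
      φ (vecMulVec (padVec m (v + w)) u) = vecMulVec (padVec p (v + w)) x := by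
  have hvm : padVec m v ≠ 0 := (hvw.padVec hm).left_ne_zero
  have hvwp := hvw.padVec hp
  have ha' : padVec q a ≠ 0 := fun h0 => ha (padVec_injective hq (h0.trans padVec_zero.symm))
  have hxU : ∀ a : Fin 2 → D, x ≠ padVec q a := fun a' hxa =>
    hu a' (hφ.vecMulVec_injective hvm (by rw [hx, h.apply_vecMulVec, hxa]))
  have hx0 : x ≠ 0 := fun h0 => hxU 0 (h0.trans padVec_zero.symm)
  obtain ⟨y, hy⟩ := exists_apply_eq_add hp hq hφ h hvw.left_ne_zero w a u
  obtain ⟨d, hd⟩ : ∃ d : D, y - x = d • padVec q a := by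
    obtain ⟨s, r, hsr⟩ := hφ.outerDiff
      (A := vecMulVec (padVec m v) u + vecMulVec (padVec m w) (padVec n a))
      (B := vecMulVec (padVec m v) u) ⟨_, _, add_sub_cancel_left _ _⟩
    rw [hy, hx] at hsr
    exact hvwp.exists_smul_eq (s := s) (r := r) (by rw [← hsr, vecMulVec_sub]; abel) ha'
  have key : ∀ t : D, t ≠ 0 → ∃ μ : D, μ ≠ 0 ∧ μ - 1 = d * t * μ ∧
      φ (vecMulVec (padVec m (v + MulOpposite.op t • w)) u) =
        vecMulVec (padVec p (v + MulOpposite.op t • w)) (μ • x) := by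
    intro t ht
    have hind := hvw.add_op_smul t
    obtain ⟨z, hz⟩ := exists_apply_eq_vecMulVec hp hq hφ h hind.left_ne_zero u
    have hz0 : z ≠ 0 := by
      rintro rfl
      refine hu 0 (hφ.vecMulVec_injective (hind.padVec hm).left_ne_zero ?_)
      rw [hz, h.apply_vecMulVec, padVec_zero]
    have expand : ∀ (k l : ℕ) (z : Fin l → D),
        vecMulVec (padVec k (v + MulOpposite.op t • w)) z =
          vecMulVec (padVec k v) z + vecMulVec (padVec k w) (t • z) := fun k l z => by
      rw [padVec_add, add_vecMulVec, padVec_op_smul, vecMulVec_smul']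
    have hμ : ∃ μ : D, z = μ • x := by
      obtain ⟨s, r, hsr⟩ := hφ.outerDiff
        (A := vecMulVec (padVec m (v + MulOpposite.op t • w)) u)
        (B := vecMulVec (padVec m v) u)
        ⟨padVec m w, t • u, by rw [expand]; abel⟩
      rw [hz, hx, expand] at hsr
      obtain ⟨c, hc⟩ := hvwp.exists_smul_eq (x := z - x) (y := t • z) (s := s) (r := r)
        (by rw [← hsr, vecMulVec_sub]; abel) (smul_ne_zero ht hz0)
      have hxz : x = (1 - c * t) • z := by
        rw [sub_smul, one_smul, ← smul_smul, ← hc]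
        abel
      have hct : 1 - c * t ≠ 0 := fun h0 => hx0 (by rw [hxz, h0, zero_smul])
      exact ⟨(1 - c * t)⁻¹, by rw [eq_inv_smul_iff₀ hct, ← hxz]⟩
    obtain ⟨μ, rfl⟩ := hμ
    have hμ0 : μ ≠ 0 := by
      rintro rfl
      exact hz0 (zero_smul _ _)
    refine ⟨μ, hμ0, ?_, hz⟩
    obtain ⟨s, r, hsr⟩ := hφ.outerDiff
      (A := vecMulVec (padVec m (v + MulOpposite.op t • w)) u)
      (B := vecMulVec (padVec m v) u + vecMulVec (padVec m w) (padVec n a))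
      ⟨padVec m w, t • u - padVec n a, by rw [expand, vecMulVec_sub]; abel⟩
    rw [hz, hy, expand] at hsr
    obtain ⟨c, hc⟩ := hvwp.exists_smul_eq (x := μ • x - y) (y := t • μ • x - padVec q a)
      (s := s) (r := r) (by rw [← hsr, vecMulVec_sub, vecMulVec_sub]; abel) (by
        intro h0
        have := smul_padVec_eq hxU ha' (α := t * μ) (β := 1)
          (by rw [one_smul, ← smul_smul]; exact sub_eq_zero.1 h0)
        exact one_ne_zero this.2)
    have hyx : y = x + d • padVec q a := by rw [← hd]; abel
    obtain ⟨h1, h2⟩ := smul_padVec_eq hxU ha' (α := μ - 1 - c * t * μ) (β := d - c) (by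
      rw [hyx, smul_sub, smul_smul, smul_smul] at hc
      rw [sub_smul, sub_smul, sub_smul, one_smul, ← sub_eq_zero]
      rw [← sub_eq_zero] at hc
      rw [← hc, mul_assoc]
      abel)
    rw [sub_eq_zero.1 h2]
    exact sub_eq_zero.1 h1
  have hd0 : d = 0 := by
    by_contra hd0
    obtain ⟨μ, -, hμ, -⟩ := key d⁻¹ (inv_ne_zero hd0)
    rw [mul_inv_cancel₀ hd0, one_mul] at hμ
    exact one_ne_zero (sub_eq_self.1 hμ)
  refine ⟨?_, ?_⟩
  · rw [hd0, zero_smul, sub_eq_zero] at hd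
    rw [hy, hd]
  · obtain ⟨μ, -, hμ, hz⟩ := key 1 one_ne_zero
    rw [hd0, zero_mul, zero_mul, sub_eq_zero] at hμ
    simpa [hμ] using hz

theorem apply_add (hm : 2 ≤ m) (hp : 2 ≤ p) (hq : 2 ≤ q)
    (hφ : PreservesOuterDiff φ) (h : FixesCorner φ) {v w : Fin 2 → D} (hvw : RightIndep v w)
    {u : Fin n → D} {x : Fin q → D}
    (hx : φ (vecMulVec (padVec m v) u) = vecMulVec (padVec p v) x) :
    (∀ a : Fin 2 → D, φ (vecMulVec (padVec m v) u + vecMulVec (padVec m w) (padVec n a)) =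
        vecMulVec (padVec p v) x + vecMulVec (padVec p w) (padVec q a)) ∧
      φ (vecMulVec (padVec m (v + w)) u) = vecMulVec (padVec p (v + w)) x := by
  by_cases hu : ∃ a : Fin 2 → D, u = padVec n a
  · obtain ⟨b, rfl⟩ := hu
    obtain rfl : padVec q b = x := by
      rw [h.apply_vecMulVec] at hx
      exact vecMulVec_right_injective (hvw.padVec hp).left_ne_zero hx
    exact ⟨fun a => h.apply_vecMulVec_add _ _ _ _, h.apply_vecMulVec _ _⟩
  · rw [not_exists] at hu
    refine ⟨fun a => ?_, ?_⟩
    · by_cases ha : a = 0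
      · simpa [ha] using hx
      · exact (apply_add_of_notMem hm hp hq hφ h hvw hu hx ha).1
    · exact (apply_add_of_notMem hm hp hq hφ h hvw hu hx (a := ![1, 0])
        fun h0 => one_ne_zero (congrFun h0 0)).2

theorem apply_of_rightIndep (hm : 2 ≤ m) (hp : 2 ≤ p) (hq : 2 ≤ q)
    (hφ : PreservesOuterDiff φ) (h : FixesCorner φ) {v w : Fin 2 → D} (hvw : RightIndep v w)
    {u : Fin n → D} {x : Fin q → D}
    (hx : φ (vecMulVec (padVec m v) u) = vecMulVec (padVec p v) x) :
    φ (vecMulVec (padVec m w) u) = vecMulVec (padVec p w) x := by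
  have h1 := (apply_add hm hp hq hφ h hvw hx).2
  have hind : RightIndep (v + w) (-v) := fun s t hst => by
    obtain ⟨h2, h3⟩ := hvw (s - t) s fun i => by
      rw [← hst i]
      simp only [Pi.add_apply, Pi.neg_apply]
      noncomm_ring
    exact ⟨h3, by rw [h3, zero_sub, neg_eq_zero] at h2; exact h2⟩
  simpa using (apply_add hm hp hq hφ h hind h1).2

theorem exists_apply_add_eq (hm : 2 ≤ m) (hp : 2 ≤ p) (hq : 2 ≤ q)
    (hφ : PreservesOuterDiff φ) (h : FixesCorner φ) {v w : Fin 2 → D} (hvw : RightIndep v w)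
    {u : Fin n → D} {x : Fin q → D}
    (hx : φ (vecMulVec (padVec m v) u) = vecMulVec (padVec p v) x) (u' : Fin n → D) :
    ∃ z, φ (vecMulVec (padVec m v) u + vecMulVec (padVec m w) u') =
      vecMulVec (padVec p v) x + vecMulVec (padVec p w) z := by
  obtain ⟨z, hz⟩ := exists_eq_vecMulVec hq (hvw.padVec hp).symm.left_ne_zero
    (Y := φ (vecMulVec (padVec m v) u + vecMulVec (padVec m w) u') - vecMulVec (padVec p v) x)
    fun a => by
      obtain ⟨s, r, hsr⟩ := hφ.outerDiff
        (A := vecMulVec (padVec m v) u + vecMulVec (padVec m w) u')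
        (B := vecMulVec (padVec m v) u + vecMulVec (padVec m w) (padVec n a))
        ⟨padVec m w, u' - padVec n a, by rw [vecMulVec_sub]; abel⟩
      refine ⟨s, r, ?_⟩
      rw [← hsr, (apply_add hm hp hq hφ h hvw hx).1]
      abel
  exact ⟨z, by rw [← hz]; abel⟩

theorem rightIndep_basis : RightIndep (![1, 0] : Fin 2 → D) ![0, 1] := fun s t h =>
  ⟨by simpa using h 0, by simpa using h 1⟩

theorem exists_linearMap (hm : 2 ≤ m) (hp : 2 ≤ p) (hq : 2 ≤ q)
    (hφ : PreservesOuterDiff φ) (h : FixesCorner φ) :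
    ∃ f : (Fin n → D) →ₗ[D] (Fin q → D), Function.Injective f ∧
      (∀ a : Fin 2 → D, f (padVec n a) = padVec q a) ∧
      ∀ u, φ (vecMulVec (padVec m ![1, 0]) u) = vecMulVec (padVec p ![1, 0]) (f u) := by
  have he := rightIndep_basis (D := D)
  have hep := he.padVec hp
  choose f hf using exists_apply_eq_vecMulVec hp hq hφ h he.left_ne_zero
  have hf2 : ∀ u, φ (vecMulVec (padVec m ![0, 1]) u) = vecMulVec (padVec p ![0, 1]) (f u) :=
    fun u => apply_of_rightIndep hm hp hq hφ h he (hf u)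
  have hfU : ∀ a : Fin 2 → D, f (padVec n a) = padVec q a := fun a =>
    vecMulVec_right_injective hep.left_ne_zero (by rw [← hf, h.apply_vecMulVec])
  have hsmul : ∀ (t : D) u, f (t • u) = t • f u := fun t u => by
    by_cases ht : t = 0
    · simpa [ht] using hfU 0
    · have h1 := apply_of_rightIndep hm hp hq hφ h (he.symm.op_smul_right ht) (hf2 u)
      rw [padVec_op_smul, padVec_op_smul, ← vecMulVec_smul', ← vecMulVec_smul', hf] at h1
      exact vecMulVec_right_injective hep.left_ne_zero h1
  have hadd : ∀ u u', f (u + u') = f u + f u' := fun u u' => by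
    obtain ⟨z₁, hz₁⟩ := exists_apply_add_eq hm hp hq hφ h he (hf u) u'
    obtain ⟨z₂, hz₂⟩ := exists_apply_add_eq hm hp hq hφ h he.symm (hf2 u') u
    have hind : RightIndep (![1, 0] : Fin 2 → D) (![0, 1] - ![1, 0]) := fun s t hst => by
      have h1 := hst 1
      have h0 := hst 0
      obtain rfl : t = 0 := by simpa using h1
      exact ⟨by simpa using h0, rfl⟩
    obtain ⟨z₃, hz₃⟩ := exists_apply_add_eq hm hp hq hφ h hind (hf (u + u')) u'
    rw [add_comm, hz₁] at hz₂
    have hz : z₁ = f u' := sub_eq_zero.1 (hep.eq_zero_of_vecMulVec_add (x := f u - z₂) (by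
      rw [vecMulVec_sub, vecMulVec_sub, ← sub_eq_zero.2 hz₂]; abel)).2
    rw [padVec_sub, sub_vecMulVec, vecMulVec_add, ← add_sub_assoc, add_right_comm,
      add_sub_cancel_right, hz₁, hz, padVec_sub, sub_vecMulVec, ← sub_eq_zero] at hz₃
    obtain ⟨h1, h2⟩ := hep.eq_zero_of_vecMulVec_add (x := f u - f (u + u') + z₃)
      (y := f u' - z₃) (by
        rw [vecMulVec_add, vecMulVec_sub, vecMulVec_sub, ← hz₃]; abel)
    rw [← sub_eq_zero, ← neg_eq_zero, ← h1, ← sub_eq_zero.1 h2]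
    abel
  refine ⟨⟨⟨f, hadd⟩, hsmul⟩, fun u u' huu => ?_, hfU, hf⟩
  refine hφ.vecMulVec_injective (he.padVec hm).left_ne_zero ?_
  rw [hf, hf]
  exact congrArg _ huu

/-- The zero-padding of row vectors as a linear map. -/
def padVecLinear (D : Type*) [DivisionRing D] (l k : ℕ) : (Fin l → D) →ₗ[D] (Fin k → D) where
  toFun := padVec k
  map_add' := padVec_add
  map_smul' := padVec_smul

theorem exists_isUnit_vecMul (hnq : n ≤ q) (f : (Fin n → D) →ₗ[D] (Fin q → D))
    (hf : Function.Injective f) :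
    ∃ S : Matrix (Fin q) (Fin q) D, IsUnit S ∧ ∀ u, f u = padVec q u ᵥ* S := by
  have hι : Function.Injective (padVecLinear D n q) := padVec_injective hnq
  obtain ⟨g, hg⟩ := Submodule.exists_linearEquiv_restrict_eq
    ((LinearEquiv.ofInjective _ hι).symm ≪≫ₗ LinearEquiv.ofInjective f hf)
  refine ⟨LinearMap.toMatrixRight' g.toLinearMap, ?_, fun u => ?_⟩
  · refine ⟨⟨_, LinearMap.toMatrixRight' g.symm.toLinearMap, ?_, ?_⟩, rfl⟩
    · rw [← LinearMap.toMatrixRight'_comp, LinearEquiv.symm_comp, LinearMap.toMatrixRight'_id]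
    · rw [← LinearMap.toMatrixRight'_comp, LinearEquiv.comp_symm, LinearMap.toMatrixRight'_id]
  · have h1 := hg (LinearEquiv.ofInjective _ hι u)
    rw [LinearEquiv.trans_apply, LinearEquiv.symm_apply_apply, LinearEquiv.ofInjective_apply,
      LinearEquiv.ofInjective_apply] at h1
    rw [h1, ← Matrix.toLinearMapRight'_apply, LinearEquiv.symm_apply_apply]
    rfl

/-- On matrices supported on the first row, `φ` is the right multiplication by an invertible
matrix. -/
theorem exists_isUnit_apply_vecMulVec (hm : 2 ≤ m) (hn : 2 ≤ n) (hp : 2 ≤ p) (hq : 2 ≤ q)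
    (hφ : PreservesOuterDiff φ) (h : FixesCorner φ) :
    n ≤ q ∧ ∃ S : Matrix (Fin q) (Fin q) D, IsUnit S ∧
      (∀ a : Fin 2 → D, padVec q a ᵥ* S = padVec q a) ∧
      ∀ u, φ (vecMulVec (padVec m ![1, 0]) u) =
        vecMulVec (padVec p ![1, 0]) (padVec q u ᵥ* S) := by
  obtain ⟨f, hf, hfU, hfφ⟩ := exists_linearMap hm hp hq hφ h
  have hnq : n ≤ q := by simpa using LinearMap.finrank_le_finrank_of_injective hf
  obtain ⟨S, hS, hfS⟩ := exists_isUnit_vecMul hnq f hf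
  refine ⟨hnq, S, hS, fun a => ?_, fun u => by rw [hfφ, hfS]⟩
  rw [← hfU a, hfS]
  congr 1
  rw [← hfS, hfU]
  ext i
  simp only [padVec]
  split_ifs <;> first | rfl | omega

end Main

section Transpose

variable {m n p q : ℕ}

/-- The transpose of a matrix, with entries in the opposite ring. -/
def opTranspose (A : Matrix (Fin m) (Fin n) D) : Matrix (Fin n) (Fin m) Dᵐᵒᵖ :=
  of fun i j => MulOpposite.op (A j i)

/-- The inverse of `opTranspose`. -/
def unopTranspose (A : Matrix (Fin m) (Fin n) Dᵐᵒᵖ) : Matrix (Fin n) (Fin m) D :=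
  of fun i j => MulOpposite.unop (A j i)

theorem opTranspose_injective :
    Function.Injective (opTranspose : Matrix (Fin m) (Fin n) D → _) := fun A B h => by
  ext i j
  exact MulOpposite.op_injective (congrFun (congrFun h j) i)

theorem OuterDiff.opTranspose {A B : Matrix (Fin m) (Fin n) D} (h : OuterDiff A B) :
    OuterDiff (opTranspose A) (opTranspose B) := by
  obtain ⟨s, r, hsr⟩ := h
  refine ⟨fun j => MulOpposite.op (r j), fun i => MulOpposite.op (s i), ?_⟩
  ext j i
  exact congrArg MulOpposite.op (congrFun (congrFun hsr i) j)

theorem OuterDiff.unopTranspose {A B : Matrix (Fin m) (Fin n) Dᵐᵒᵖ} (h : OuterDiff A B) :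
    OuterDiff (unopTranspose A) (unopTranspose B) := by
  obtain ⟨s, r, hsr⟩ := h
  refine ⟨fun j => MulOpposite.unop (r j), fun i => MulOpposite.unop (s i), ?_⟩
  ext j i
  exact congrArg MulOpposite.unop (congrFun (congrFun hsr i) j)

theorem unopTranspose_opTranspose (A : Matrix (Fin m) (Fin n) D) :
    unopTranspose (opTranspose A) = A := rfl

theorem unopTranspose_injective :
    Function.Injective (unopTranspose : Matrix (Fin m) (Fin n) Dᵐᵒᵖ → _) := fun A B h => by
  ext i j
  exact MulOpposite.unop_injective (congrFun (congrFun h j) i)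

variable {φ : Matrix (Fin m) (Fin n) D → Matrix (Fin p) (Fin q) D}

theorem PreservesOuterDiff.opTranspose (hφ : PreservesOuterDiff φ) :
    PreservesOuterDiff fun A => opTranspose (φ (unopTranspose A)) := fun _ _ hAB hd =>
  have h := hφ _ _ (unopTranspose_injective.ne hAB) hd.unopTranspose
  ⟨opTranspose_injective.ne h.1, h.2.opTranspose⟩

theorem FixesCorner.opTranspose (h : FixesCorner φ) :
    FixesCorner fun A => opTranspose (φ (unopTranspose A)) := fun A => by
  have h1 : ∀ k l, unopTranspose (pad k l A) = pad l k (unopTranspose A) := fun k l => by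
    ext i j
    simp only [pad, _root_.unopTranspose, of_apply]
    split_ifs <;> rfl
  apply unopTranspose_injective
  rw [unopTranspose_opTranspose, h1, h, h1]

theorem unopTranspose_mul {k : ℕ} (A B : Matrix (Fin k) (Fin k) Dᵐᵒᵖ) :
    unopTranspose (A * B) = unopTranspose B * unopTranspose A := by
  ext i j
  simp [unopTranspose, Matrix.mul_apply]

theorem unopTranspose_one {k : ℕ} :
    unopTranspose (1 : Matrix (Fin k) (Fin k) Dᵐᵒᵖ) = 1 := by
  ext i j
  by_cases hij : i = j
  · subst hij
    simp [unopTranspose]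
  · simp [unopTranspose, Matrix.one_apply_ne hij, Matrix.one_apply_ne (Ne.symm hij)]

theorem isUnit_unopTranspose {k : ℕ} {S : Matrix (Fin k) (Fin k) Dᵐᵒᵖ} (hS : IsUnit S) :
    IsUnit (unopTranspose S) := by
  obtain ⟨⟨S, R, h1, h2⟩, rfl⟩ := hS
  exact ⟨⟨unopTranspose S, unopTranspose R, by rw [← unopTranspose_mul, h2, unopTranspose_one],
    by rw [← unopTranspose_mul, h1, unopTranspose_one]⟩, rfl⟩

theorem unopTranspose_mulVec {k : ℕ} (S : Matrix (Fin k) (Fin k) Dᵐᵒᵖ) (u : Fin k → D) :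
    unopTranspose S *ᵥ u =
      fun i => MulOpposite.unop (((fun j => MulOpposite.op (u j)) ᵥ* S) i) := by
  ext i
  simp [unopTranspose, Matrix.mulVec, Matrix.vecMul, dotProduct]

theorem padVec_op {l k : ℕ} (u : Fin l → D) :
    padVec k (fun i => MulOpposite.op (u i)) = fun i => MulOpposite.op (padVec k u i) := by
  ext i
  simp only [padVec]
  split_ifs <;> rfl

theorem unopTranspose_vecMulVec (v : Fin m → Dᵐᵒᵖ) (x : Fin n → Dᵐᵒᵖ) :
    unopTranspose (vecMulVec v x) =
      vecMulVec (fun i => MulOpposite.unop (x i)) fun i => MulOpposite.unop (v i) := rfl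

/-- On matrices supported on the first column, `φ` is the left multiplication by an invertible
matrix. -/
theorem exists_isUnit_apply_vecMulVec_left (hm : 2 ≤ m) (hn : 2 ≤ n) (hp : 2 ≤ p) (hq : 2 ≤ q)
    (hφ : PreservesOuterDiff φ) (h : FixesCorner φ) :
    m ≤ p ∧ ∃ T : Matrix (Fin p) (Fin p) D, IsUnit T ∧
      (∀ a : Fin 2 → D, T *ᵥ padVec p a = padVec p a) ∧
      ∀ u, φ (vecMulVec u (padVec n ![1, 0])) =
        vecMulVec (T *ᵥ padVec p u) (padVec q ![1, 0]) := by
  obtain ⟨hmp, S, hS, hSU, hSφ⟩ :=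
    exists_isUnit_apply_vecMulVec hn hm hq hp hφ.opTranspose h.opTranspose
  refine ⟨hmp, unopTranspose S, isUnit_unopTranspose hS, fun a => ?_, fun u => ?_⟩
  · rw [unopTranspose_mulVec, ← padVec_op, hSU, padVec_op]
    rfl
  · have he : ∀ k, (fun i => MulOpposite.unop (padVec k (![1, 0] : Fin 2 → Dᵐᵒᵖ) i)) =
        padVec k (![1, 0] : Fin 2 → D) := fun k => by
      have h1 : (![1, 0] : Fin 2 → Dᵐᵒᵖ) = fun i => MulOpposite.op ((![1, 0] : Fin 2 → D) i) := by
        ext i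
        fin_cases i <;> rfl
      rw [h1, padVec_op]
      rfl
    have h1 := congrArg unopTranspose (hSφ fun i => MulOpposite.op (u i))
    rw [unopTranspose_opTranspose, unopTranspose_vecMulVec, unopTranspose_vecMulVec, he, he,
      padVec_op] at h1
    rw [unopTranspose_mulVec]
    exact h1

end Transpose

theorem padVec_basis (k : ℕ) :
    padVec k (![1, 0] : Fin 2 → D) = fun i : Fin k => if (i : ℕ) = 0 then (1 : D) else 0 := by
  ext ⟨i, hi⟩
  rcases i with _ | _ | i <;> simp [padVec]

/-- Lemma 3.15. -/
theorem stmt12 (hEAS : EAS D) (m n p q : ℕ) (hm : 2 ≤ m) (hn : 2 ≤ n) (hp : 2 ≤ p)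
    (hq : 2 ≤ q)
    (φ : Matrix (Fin m) (Fin n) D → Matrix (Fin p) (Fin q) D)
    (hφ : ∀ A B, Adjacent A B → Adjacent (φ A) (φ B))
    (h : ∀ A : Matrix (Fin 2) (Fin 2) D, φ (pad m n A) = pad p q A) :
    m ≤ p ∧ n ≤ q ∧
      ∃ T : Matrix (Fin p) (Fin p) D, ∃ S : Matrix (Fin q) (Fin q) D,
        IsUnit T ∧ IsUnit S ∧
        ∀ M : Matrix (Fin m) (Fin n) D,
          M ∈ Rvec (fun j : Fin n => if (j : ℕ) = 0 then (1 : D) else 0) ∪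
              Lvec (fun i : Fin m => if (i : ℕ) = 0 then (1 : D) else 0) →
          φ M = T * pad p q M * S := by
  have hφ' : PreservesOuterDiff φ := fun A B hAB hd =>
    (adjacent_iff _ _).1 (hφ A B ((adjacent_iff A B).2 ⟨hAB, hd⟩))
  obtain ⟨hnq, S, hS, hSU, hSφ⟩ := exists_isUnit_apply_vecMulVec hm hn hp hq hφ' h
  obtain ⟨hmp, T, hT, hTU, hTφ⟩ := exists_isUnit_apply_vecMulVec_left hm hn hp hq hφ' h
  have hpad : ∀ k l : ℕ, 2 ≤ l →
      padVec k (padVec l (![1, 0] : Fin 2 → D)) = padVec k ![1, 0] := fun k l hl => by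
    ext i
    simp only [padVec]
    split_ifs <;> first | rfl | omega
  refine ⟨hmp, hnq, T, S, hT, hS, ?_⟩
  rintro M (⟨u, hu⟩ | ⟨u, hu⟩)
  · obtain rfl : M = vecMulVec u (padVec n ![1, 0]) := by
      ext i j
      rw [hu, padVec_basis, vecMulVec_apply]
    rw [hTφ, pad_vecMulVec, mul_vecMulVec, vecMulVec_mul, hpad _ _ hn, hSU]
  · obtain rfl : M = vecMulVec (padVec m ![1, 0]) u := by
      ext i j
      rw [hu, padVec_basis, vecMulVec_apply]
    rw [hSφ, pad_vecMulVec, mul_vecMulVec, vecMulVec_mul, hpad _ _ hm, hTU]
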